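/- Let n ≥ 1, Q = 2n+2, and suppose 1 < p < ∞, 1 < q' < ∞, q is the Hölder conjugate of q' (1/q + 1/q' = 1), p' is the Hölder conjugate of p, 0 < λ < Q, α + β ≥ 0, λ + α + β ≤ Q, β < 2n/p', α < 2n/q, and 1/p + 1/q' + (λ+α+β)/Q = 2. Let (g_i) be nonnegative with ‖g_i(v)·|z'|^{β}‖_{L^p(ℍⁿ)} = 1 which is tight in the sense that for every δ > 0 there exists R > 0 such that ∫_{B_ℍ(0,R)} |g_i(v)|^p |z'|^{βp} dv ≥ 1 − δ for all i, and suppose g_i(v)|z'|^{β} converges weakly in L^p(ℍⁿ) to g(v)|z'|^{β}. Then, after passing to a subsequence, I_λ(g_i)(u)·|z|^{-α} → I_λ(g)(u)·|z|^{-α} for almost every u = (z,t) ∈ ℍⁿ. -/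

import Mathlib

open MeasureTheory ENNReal Filter

noncomputable section

/-- The Heisenberg group `ℍⁿ = ℂⁿ × ℝ` (as a measure space, with Lebesgue/Haar measure). -/
abbrev Hn (n : ℕ) := (Fin n → ℂ) × ℝ

/-- Euclidean norm of the `ℂⁿ` component. -/
def znorm {n : ℕ} (z : Fin n → ℂ) : ℝ := Real.sqrt (∑ j, Complex.normSq (z j))

/-- Homogeneous norm `|u| = (|z|⁴ + t²)^{1/4}` on the Heisenberg group. -/
def Hnorm {n : ℕ} (u : Hn n) : ℝ := (znorm u.1 ^ 4 + u.2 ^ 2) ^ ((1 : ℝ)/4)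

/-- Heisenberg group law `(z,t)·(z',t') = (z+z', t+t'+2 Im (z ⬝ conj z'))`. -/
def Hmul {n : ℕ} (u v : Hn n) : Hn n :=
  (u.1 + v.1, u.2 + v.2 + 2 * (∑ j, u.1 j * (starRingEnd ℂ) (v.1 j)).im)

/-- Heisenberg group inverse `(z,t)⁻¹ = (-z,-t)`. -/
def Hinv {n : ℕ} (u : Hn n) : Hn n := (-u.1, -u.2)

/-- Left-invariant quasi-distance `d(u,v) = |u⁻¹ v|`. -/
def Hdist {n : ℕ} (u v : Hn n) : ℝ := Hnorm (Hmul (Hinv u) v)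

/-- Heisenberg ball `B_ℍ(u,R)`. -/
def Hball {n : ℕ} (u : Hn n) (R : ℝ) : Set (Hn n) := {v | Hdist u v < R}

/-- Fractional integral operator `I_λ(g)(u) = ∫ g(v)/|u⁻¹v|^λ dv`. -/
def Ilam {n : ℕ} (lam : ℝ) (g : Hn n → ℝ) (u : Hn n) : ℝ :=
  ∫ v, g v / Hdist u v ^ lam

lemma integrable_norm_rpow_mul_one_add_norm_rpow {E : Type*} [NormedAddCommGroup E]
    [NormedSpace ℝ E] [FiniteDimensional ℝ E] [Nontrivial E] [MeasurableSpace E] [BorelSpace E]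
    (μ : Measure E) [μ.IsAddHaarMeasure] {a m : ℝ} (ha : a < Module.finrank ℝ E)
    (ham : Module.finrank ℝ E < a + m) :
    Integrable (fun x : E => ‖x‖ ^ (-a) * (1 + ‖x‖) ^ (-m)) μ := by
  rw [integrable_fun_norm_addHaar μ (f := fun y : ℝ => y ^ (-a) * (1 + y) ^ (-m))]
  set d := Module.finrank ℝ E with hd
  have hd1 : 1 ≤ d := Module.finrank_pos
  have hm : 0 < m := by linarith
  have key : ∀ y : ℝ, 0 < y → y ^ (d - 1) • (y ^ (-a) * (1 + y) ^ (-m))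
      = y ^ ((d : ℝ) - 1 - a) * (1 + y) ^ (-m) := by
    intro y hy
    rw [smul_eq_mul, ← mul_assoc, ← Real.rpow_natCast, ← Real.rpow_add hy]
    congr 2
    push_cast [hd1]; ring
  have meas : Measurable (fun y : ℝ => y ^ (d - 1) • (y ^ (-a) * (1 + y) ^ (-m))) := by
    fun_prop
  rw [← Set.Ioc_union_Ioi_eq_Ioi (zero_le_one' ℝ)]
  refine IntegrableOn.union ?_ ?_
  · have h0 : IntegrableOn (fun y : ℝ => y ^ ((d : ℝ) - 1 - a)) (Set.Ioc 0 1) := by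
      rw [← intervalIntegrable_iff_integrableOn_Ioc_of_le zero_le_one]
      exact intervalIntegral.intervalIntegrable_rpow' (by linarith)
    refine Integrable.mono' h0 meas.aestronglyMeasurable ?_
    refine ae_restrict_of_forall_mem measurableSet_Ioc fun y hy => ?_
    have hy0 : 0 < y := hy.1
    rw [key y hy0, Real.norm_of_nonneg (by positivity)]
    refine mul_le_of_le_one_right (by positivity) ?_
    exact Real.rpow_le_one_of_one_le_of_nonpos (by linarith) (by linarith)
  · have h0 : IntegrableOn (fun y : ℝ => y ^ ((d : ℝ) - 1 - a - m)) (Set.Ioi 1) :=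
      integrableOn_Ioi_rpow_of_lt (by linarith) one_pos
    refine Integrable.mono' h0 meas.aestronglyMeasurable ?_
    refine ae_restrict_of_forall_mem measurableSet_Ioi fun y hy => ?_
    have hy0 : 0 < y := lt_trans one_pos hy
    rw [key y hy0, Real.norm_of_nonneg (by positivity), sub_eq_add_neg _ m, Real.rpow_add hy0]
    refine mul_le_mul_of_nonneg_left ?_ (by positivity)
    exact Real.rpow_le_rpow_of_nonpos hy0 (by linarith) (by linarith)

lemma znorm_nonneg {n : ℕ} (z : Fin n → ℂ) : 0 ≤ znorm z := Real.sqrt_nonneg _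

lemma norm_le_znorm {n : ℕ} (z : Fin n → ℂ) : ‖z‖ ≤ znorm z := by
  refine (pi_norm_le_iff_of_nonneg (znorm_nonneg z)).2 fun j => ?_
  refine Real.le_sqrt_of_sq_le ?_
  rw [← Complex.normSq_eq_norm_sq]
  exact Finset.single_le_sum (f := fun j => Complex.normSq (z j))
    (fun i _ => Complex.normSq_nonneg _) (Finset.mem_univ j)

lemma znorm_le_sqrt_mul_norm {n : ℕ} (z : Fin n → ℂ) : znorm z ≤ √n * ‖z‖ := by
  have h : ∑ j, Complex.normSq (z j) ≤ n * ‖z‖ ^ 2 := by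
    calc ∑ j, Complex.normSq (z j) ≤ ∑ _j : Fin n, ‖z‖ ^ 2 := by
          refine Finset.sum_le_sum fun j _ => ?_
          rw [Complex.normSq_eq_norm_sq]
          exact pow_le_pow_left₀ (norm_nonneg _) (norm_le_pi_norm z j) 2
      _ = n * ‖z‖ ^ 2 := by simp
  calc znorm z ≤ √(n * ‖z‖ ^ 2) := Real.sqrt_le_sqrt h
    _ = √n * ‖z‖ := by rw [Real.sqrt_mul (by positivity), Real.sqrt_sq (norm_nonneg _)]

lemma continuous_znorm {n : ℕ} : Continuous (znorm (n := n)) := by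
  unfold znorm
  have := Complex.continuous_normSq
  fun_prop

lemma measurable_znorm {n : ℕ} : Measurable (znorm (n := n)) := continuous_znorm.measurable

lemma exists_znorm_rpow_le {n : ℕ} (s : ℝ) :
    ∃ C : ℝ, ∀ z : Fin n → ℂ, znorm z ^ s ≤ C * ‖z‖ ^ s := by
  rcases le_total 0 s with hs | hs
  · refine ⟨√n ^ s, fun z => ?_⟩
    rw [← Real.mul_rpow (Real.sqrt_nonneg _) (norm_nonneg _)]
    exact Real.rpow_le_rpow (znorm_nonneg z) (znorm_le_sqrt_mul_norm z) hs
  · refine ⟨1, fun z => ?_⟩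
    rw [one_mul]
    rcases eq_or_ne z 0 with rfl | hz
    · simp [znorm]
    · exact Real.rpow_le_rpow_of_nonpos (norm_pos_iff.2 hz) (norm_le_znorm z) hs

lemma znorm_pos {n : ℕ} {z : Fin n → ℂ} (hz : z ≠ 0) : 0 < znorm z :=
  (norm_pos_iff.2 hz).trans_le (norm_le_znorm z)

lemma Hnorm_nonneg {n : ℕ} (u : Hn n) : 0 ≤ Hnorm u := by unfold Hnorm; positivity

lemma Hnorm_pow_four {n : ℕ} (u : Hn n) : Hnorm u ^ 4 = znorm u.1 ^ 4 + u.2 ^ 2 := by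
  unfold Hnorm
  rw [← Real.rpow_natCast, ← Real.rpow_mul (by positivity)]
  norm_num

lemma norm_fst_le_Hnorm {n : ℕ} (u : Hn n) : ‖u.1‖ ≤ Hnorm u := by
  refine (norm_le_znorm u.1).trans (le_of_pow_le_pow_left₀ four_ne_zero (Hnorm_nonneg u) ?_)
  rw [Hnorm_pow_four]
  linarith [sq_nonneg u.2]

lemma abs_snd_le_Hnorm_sq {n : ℕ} (u : Hn n) : |u.2| ≤ Hnorm u ^ 2 := by
  refine le_of_pow_le_pow_left₀ two_ne_zero (by positivity) ?_
  rw [← pow_mul, Hnorm_pow_four, sq_abs]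
  have := pow_nonneg (znorm_nonneg u.1) 4
  linarith

lemma continuous_Hdist {n : ℕ} : Continuous fun x : Hn n × Hn n => Hdist x.1 x.2 := by
  unfold Hdist Hnorm
  refine Continuous.rpow_const ?_ fun _ => Or.inr (by norm_num)
  have := continuous_znorm (n := n)
  unfold Hmul Hinv
  have h1 : Continuous fun x : Hn n × Hn n =>
      (∑ j, (-x.1.1) j * (starRingEnd ℂ) (x.2.1 j)).im := by
    refine Complex.continuous_im.comp (continuous_finsetSum _ fun j _ => ?_)
    refine Continuous.mul (by fun_prop) (Complex.continuous_conj.comp (by fun_prop))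
  fun_prop

lemma Hdist_nonneg {n : ℕ} (u v : Hn n) : 0 ≤ Hdist u v := Hnorm_nonneg _

lemma norm_fst_le_add_Hdist {n : ℕ} (u v : Hn n) : ‖v.1‖ ≤ ‖u.1‖ + Hdist u v := by
  have h : ‖-u.1 + v.1‖ ≤ Hdist u v := norm_fst_le_Hnorm (Hmul (Hinv u) v)
  calc ‖v.1‖ = ‖u.1 + (-u.1 + v.1)‖ := by simp
    _ ≤ _ := (norm_add_le _ _).trans (by gcongr)

lemma abs_snd_le_add_Hdist {n : ℕ} (u v : Hn n) :
    |v.2| ≤ |u.2| + Hdist u v ^ 2 + 2 * (n * ‖u.1‖ * Hdist u v) := by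
  have h1 : ‖-u.1 + v.1‖ ≤ Hdist u v := norm_fst_le_Hnorm (Hmul (Hinv u) v)
  have h2 : |(-u.2 + v.2 + 2 * (∑ j, (-u.1) j * (starRingEnd ℂ) (v.1 j)).im)| ≤ Hdist u v ^ 2 :=
    abs_snd_le_Hnorm_sq (Hmul (Hinv u) v)
  set I := (∑ j, (-u.1) j * (starRingEnd ℂ) (v.1 j)).im with hI
  have h3 : I = (∑ j, (-u.1) j * (starRingEnd ℂ) ((-u.1 + v.1) j)).im := by
    rw [hI, Complex.im_sum, Complex.im_sum]
    refine Finset.sum_congr rfl fun j _ => ?_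
    simp only [Pi.neg_apply, Pi.add_apply, map_add, map_neg, Complex.mul_im, Complex.add_re,
      Complex.add_im, Complex.neg_re, Complex.neg_im, Complex.conj_re, Complex.conj_im]
    ring
  have h4 : |I| ≤ n * ‖u.1‖ * Hdist u v := by
    rw [h3]
    refine (Complex.abs_im_le_norm _).trans ((norm_sum_le _ _).trans ?_)
    calc ∑ j, ‖(-u.1) j * (starRingEnd ℂ) ((-u.1 + v.1) j)‖
        ≤ ∑ _j : Fin n, ‖u.1‖ * Hdist u v := by
          refine Finset.sum_le_sum fun j _ => ?_
          rw [norm_mul, RCLike.norm_conj]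
          refine mul_le_mul ?_ ((norm_le_pi_norm _ j).trans h1) (norm_nonneg _) (norm_nonneg _)
          simpa using norm_le_pi_norm u.1 j
      _ = n * ‖u.1‖ * Hdist u v := by simp [mul_assoc]
  have e : v.2 = u.2 + (-u.2 + v.2 + 2 * I) - 2 * I := by ring
  calc |v.2| = |u.2 + (-u.2 + v.2 + 2 * I) - 2 * I| := by rw [← e]
    _ ≤ |u.2| + |-u.2 + v.2 + 2 * I| + |2 * I| :=
        (abs_sub _ _).trans (by gcongr; exact abs_add_le _ _)
    _ ≤ _ := by rw [abs_mul, abs_two]; gcongr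

/-- A product weight comparable, for `lam = m₁ + 2 * m₂`, with a bounded multiple of
`(1 + |v|) ^ (-lam)` from above. -/
def decayWeight {n : ℕ} (m₁ m₂ : ℝ) (v : Hn n) : ℝ :=
  (1 + ‖v.1‖) ^ (-m₁) * (1 + |v.2|) ^ (-m₂)

lemma decayWeight_pos {n : ℕ} (m₁ m₂ : ℝ) (v : Hn n) : 0 < decayWeight m₁ m₂ v := by
  unfold decayWeight; positivity

lemma measurable_decayWeight {n : ℕ} (m₁ m₂ : ℝ) :
    Measurable (decayWeight (n := n) m₁ m₂) := by
  unfold decayWeight; fun_prop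

lemma measurable_Hdist {n : ℕ} : Measurable (Function.uncurry (Hdist (n := n))) :=
  continuous_Hdist.measurable

lemma measurable_Hdist_right {n : ℕ} (u : Hn n) : Measurable fun v => Hdist u v :=
  Measurable.of_uncurry_left measurable_Hdist

lemma measurable_Hdist_left {n : ℕ} (v : Hn n) : Measurable fun u => Hdist u v :=
  Measurable.of_uncurry_right measurable_Hdist

lemma exists_inv_Hdist_rpow_le {n : ℕ} {m₁ m₂ lam : ℝ} (h₁ : 0 ≤ m₁) (h₂ : 0 ≤ m₂)
    (hm : m₁ + 2 * m₂ = lam) (u : Hn n) {ε : ℝ} (hε : 0 < ε) :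
    ∃ C : ℝ, ∀ v, ε ≤ Hdist u v → (Hdist u v ^ lam)⁻¹ ≤ C * decayWeight m₁ m₂ v := by
  set A : ℝ := (1 + ‖u.1‖) / ε + 1 with hA
  set B : ℝ := (1 + |u.2|) / ε ^ 2 + 1 + 2 * (n * ‖u.1‖) / ε with hB
  have hA0 : 0 < A := by positivity
  have hB0 : 0 < B := by positivity
  refine ⟨A ^ m₁ * B ^ m₂, fun v hv => ?_⟩
  set d := Hdist u v with hd
  have hd0 : 0 < d := hε.trans_le hv
  have hr : 1 ≤ d / ε := (one_le_div hε).2 hv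
  have e1 : 1 + ‖v.1‖ ≤ A * d := by
    have := norm_fst_le_add_Hdist u v
    calc 1 + ‖v.1‖ ≤ (1 + ‖u.1‖) * 1 + d := by linarith
      _ ≤ (1 + ‖u.1‖) * (d / ε) + d := by gcongr
      _ = A * d := by rw [hA]; ring
  have e2 : 1 + |v.2| ≤ B * d ^ 2 := by
    have := abs_snd_le_add_Hdist u v
    calc 1 + |v.2| ≤ (1 + |u.2|) * 1 ^ 2 + d ^ 2 + 2 * (n * ‖u.1‖) * d * 1 := by
          rw [← hd] at this; linarith
      _ ≤ (1 + |u.2|) * (d / ε) ^ 2 + d ^ 2 + 2 * (n * ‖u.1‖) * d * (d / ε) := by gcongr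
      _ = B * d ^ 2 := by rw [hB]; field_simp
  have k1 : (A * d) ^ (-m₁) ≤ (1 + ‖v.1‖) ^ (-m₁) :=
    Real.rpow_le_rpow_of_nonpos (by positivity) e1 (by linarith)
  have k2 : (B * d ^ 2) ^ (-m₂) ≤ (1 + |v.2|) ^ (-m₂) :=
    Real.rpow_le_rpow_of_nonpos (by positivity) e2 (by linarith)
  have e3 : (d ^ lam)⁻¹ = A ^ m₁ * B ^ m₂ * ((A * d) ^ (-m₁) * (B * d ^ 2) ^ (-m₂)) := by
    rw [Real.mul_rpow hA0.le hd0.le, Real.mul_rpow hB0.le (by positivity),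
      Real.rpow_neg hA0.le, Real.rpow_neg hB0.le, ← Real.rpow_natCast, ← Real.rpow_mul hd0.le,
      ← hm, ← Real.rpow_neg hd0.le]
    have : d ^ (-(m₁ + 2 * m₂)) = d ^ (-m₁) * d ^ (((2 : ℕ) : ℝ) * -m₂) := by
      rw [← Real.rpow_add hd0]; congr 1; push_cast; ring
    rw [this]
    have := (Real.rpow_pos_of_pos hA0 m₁).ne'
    have := (Real.rpow_pos_of_pos hB0 m₂).ne'
    field_simp
  rw [e3]
  unfold decayWeight
  gcongr

lemma exists_one_le_mul_decayWeight {n : ℕ} {m₁ m₂ : ℝ} (h₁ : 0 ≤ m₁) (h₂ : 0 ≤ m₂) (R : ℝ) :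
    ∃ C : ℝ, 0 < C ∧ ∀ u v : Hn n, u ∈ Metric.closedBall (0 : Hn n) R → Hdist u v < 1 →
      1 ≤ C * decayWeight m₁ m₂ v := by
  set A : ℝ := 2 + |R| with hA
  set B : ℝ := 2 + |R| + 2 * (n * |R|) with hB
  have hA0 : 0 < A := by positivity
  have hB0 : 0 < B := by positivity
  refine ⟨A ^ m₁ * B ^ m₂, by positivity, fun u v hu hv => ?_⟩
  have hu' : ‖u‖ ≤ |R| := (mem_closedBall_zero_iff.1 hu).trans (le_abs_self R)
  have hu1 : ‖u.1‖ ≤ |R| := (norm_fst_le u).trans hu'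
  have hu2 : |u.2| ≤ |R| := (norm_snd_le u).trans hu'
  have hd0 := Hdist_nonneg u v
  have e1 : 1 + ‖v.1‖ ≤ A := by
    have := norm_fst_le_add_Hdist u v
    linarith
  have e2 : 1 + |v.2| ≤ B := by
    have h := abs_snd_le_add_Hdist u v
    have h3 : Hdist u v ^ 2 ≤ 1 := pow_le_one₀ hd0 hv.le
    have h4 : n * ‖u.1‖ * Hdist u v ≤ n * |R| * 1 := by gcongr
    linarith
  have k1 : A ^ (-m₁) ≤ (1 + ‖v.1‖) ^ (-m₁) :=
    Real.rpow_le_rpow_of_nonpos (by positivity) e1 (by linarith)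
  have k2 : B ^ (-m₂) ≤ (1 + |v.2|) ^ (-m₂) :=
    Real.rpow_le_rpow_of_nonpos (by positivity) e2 (by linarith)
  calc 1 = A ^ m₁ * B ^ m₂ * (A ^ (-m₁) * B ^ (-m₂)) := by
        rw [Real.rpow_neg hA0.le, Real.rpow_neg hB0.le]
        have := (Real.rpow_pos_of_pos hA0 m₁).ne'
        have := (Real.rpow_pos_of_pos hB0 m₂).ne'
        field_simp
    _ ≤ _ := by unfold decayWeight; gcongr

lemma finrank_real_pi_complex (n : ℕ) : Module.finrank ℝ (Fin n → ℂ) = 2 * n := by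
  rw [Module.finrank_pi_fintype]; simp [mul_comm]

lemma integrable_mul_prod_of_finrank {n : ℕ} (hn : 1 ≤ n) {a m b k : ℝ} (ha : a < 2 * n)
    (ham : 2 * n < a + m) (hb : b < 1) (hbk : 1 < b + k) :
    Integrable (fun v : Hn n => (‖v.1‖ ^ (-a) * (1 + ‖v.1‖) ^ (-m)) *
      (|v.2| ^ (-b) * (1 + |v.2|) ^ (-k))) := by
  have : Nonempty (Fin n) := ⟨⟨0, hn⟩⟩
  have e : ((Module.finrank ℝ (Fin n → ℂ) : ℕ) : ℝ) = 2 * n := by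
    rw [finrank_real_pi_complex]; push_cast; rfl
  have h1 := integrable_norm_rpow_mul_one_add_norm_rpow (volume : Measure (Fin n → ℂ))
    (a := a) (m := m) (by rw [e]; exact ha) (by rw [e]; exact ham)
  have h2 := integrable_norm_rpow_mul_one_add_norm_rpow (volume : Measure ℝ)
    (a := b) (m := k) (by simpa using hb) (by simpa using hbk)
  exact h1.mul_prod h2

lemma memLp_znorm_rpow_mul_decayWeight {n : ℕ} (hn : 1 ≤ n) {m₁ m₂ β r : ℝ} (hr : 0 < r)
    (h₀ : r * β < 2 * n) (h₁ : 2 * n < r * β + r * m₁) (h₂ : 1 < r * m₂) :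
    MemLp (fun v : Hn n => znorm v.1 ^ (-β) * decayWeight m₁ m₂ v) (ENNReal.ofReal r) := by
  have meas : Measurable (fun v : Hn n => znorm v.1 ^ (-β) * decayWeight m₁ m₂ v) := by
    have := measurable_decayWeight (n := n) m₁ m₂
    have := measurable_znorm (n := n)
    fun_prop
  rw [← integrable_norm_rpow_iff meas.aestronglyMeasurable (by simpa using hr) (by simp)]
  rw [ENNReal.toReal_ofReal hr.le]
  obtain ⟨C, hC⟩ := exists_znorm_rpow_le (n := n) (-(r * β))
  refine ((integrable_mul_prod_of_finrank hn (a := r * β) (m := r * m₁) (b := 0) (k := r * m₂)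
    h₀ h₁ one_pos (by simpa using h₂)).const_mul C).mono'
    (meas.norm.pow_const r).aestronglyMeasurable (ae_of_all _ fun v => ?_)
  have hz := znorm_nonneg v.1
  have hw := (decayWeight_pos m₁ m₂ v).le
  rw [Real.norm_of_nonneg (by positivity), Real.norm_of_nonneg (by positivity),
    Real.mul_rpow (by positivity) hw, ← Real.rpow_mul hz]
  unfold decayWeight
  rw [Real.mul_rpow (by positivity) (by positivity), ← Real.rpow_mul (by positivity),
    ← Real.rpow_mul (by positivity)]
  have e1 : -β * r = -(r * β) := by ring
  have e2 : -m₁ * r = -(r * m₁) := by ring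
  have e3 : -m₂ * r = -(r * m₂) := by ring
  rw [e1, e2, e3, ← mul_assoc C, ← mul_assoc C]
  simp only [neg_zero, Real.rpow_zero, one_mul]
  have h := hC v.1
  rw [← mul_assoc]
  gcongr

lemma lintegral_shear_sub_left {n : ℕ} {Φ : Hn n → ℝ≥0∞} (hΦ : Measurable Φ) (a : Fin n → ℂ)
    {c : (Fin n → ℂ) → ℝ} (hc : Measurable c) :
    ∫⁻ u : Hn n, Φ (a - u.1, c u.1 - u.2) = ∫⁻ u, Φ u := by
  have hm1 : Measurable fun u : Hn n => Φ (a - u.1, c u.1 - u.2) := hΦ.comp (by fun_prop)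
  rw [Measure.volume_eq_prod, lintegral_prod _ hm1.aemeasurable, lintegral_prod _ hΦ.aemeasurable]
  have key : ∀ z : Fin n → ℂ, ∫⁻ t : ℝ, Φ (a - z, c z - t) = ∫⁻ t : ℝ, Φ (a - z, t) :=
    fun z => lintegral_sub_left_eq_self (fun t : ℝ => Φ (a - z, t)) (c z)
  simp_rw [key]
  exact lintegral_sub_left_eq_self (fun z : Fin n → ℂ => ∫⁻ t : ℝ, Φ (z, t)) a

lemma measurable_Hnorm {n : ℕ} : Measurable (Hnorm (n := n)) := by
  have := measurable_znorm (n := n)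
  unfold Hnorm
  fun_prop

lemma lintegral_comp_Hdist {n : ℕ} {F : ℝ → ℝ≥0∞} (hF : Measurable F) (v : Hn n) :
    ∫⁻ u, F (Hdist u v) = ∫⁻ u : Hn n, F (Hnorm u) := by
  have hc : Measurable fun z : Fin n → ℂ =>
      v.2 + 2 * (∑ j, (-z) j * (starRingEnd ℂ) (v.1 j)).im := by
    have : Continuous fun z : Fin n → ℂ => (∑ j, (-z) j * (starRingEnd ℂ) (v.1 j)).im :=
      Complex.continuous_im.comp (continuous_finsetSum _ fun j _ => by fun_prop)
    exact (this.const_mul 2).measurable.const_add _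
  refine Eq.trans ?_ (lintegral_shear_sub_left (hF.comp measurable_Hnorm) v.1 hc)
  refine lintegral_congr fun u => congrArg F (congrArg Hnorm (Prod.ext ?_ ?_))
  · simp only [Hmul, Hinv]; abel
  · simp only [Hmul, Hinv]; ring

/-- The kernel `s ^ (-lam)` truncated to `s < ε`, as an extended nonnegative function. -/
def nearKernel (lam ε : ℝ) : ℝ → ℝ≥0∞ :=
  (Set.Iio ε).indicator fun s => ENNReal.ofReal (s ^ lam)⁻¹

/-- The kernel `s ^ (-lam)` truncated to `ε ≤ s`. -/
def farKernel (lam ε : ℝ) : ℝ → ℝ :=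
  (Set.Ici ε).indicator fun s => (s ^ lam)⁻¹

lemma measurable_nearKernel (lam ε : ℝ) : Measurable (nearKernel lam ε) :=
  Measurable.indicator (by fun_prop) measurableSet_Iio

lemma measurable_farKernel (lam ε : ℝ) : Measurable (farKernel lam ε) :=
  Measurable.indicator (by fun_prop) measurableSet_Ici

lemma ae_fst_ne_zero {n : ℕ} (hn : 1 ≤ n) : ∀ᵐ v : Hn n, v.1 ≠ 0 := by
  have : Nonempty (Fin n) := ⟨⟨0, hn⟩⟩
  rw [Measure.volume_eq_prod]
  exact Measure.quasiMeasurePreserving_fst.ae (p := fun z : Fin n → ℂ => z ≠ 0)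
    (Measure.ae_ne _ _)

lemma ae_snd_ne_zero {n : ℕ} : ∀ᵐ v : Hn n, v.2 ≠ 0 := by
  rw [Measure.volume_eq_prod]
  exact Measure.quasiMeasurePreserving_snd.ae (p := fun t : ℝ => t ≠ 0) (Measure.ae_ne _ _)

lemma lintegral_nearKernel_one_lt_top {n : ℕ} (hn : 1 ≤ n) {lam : ℝ} (h0 : 0 < lam)
    (hQ : lam < 2 * n + 2) : ∫⁻ u : Hn n, nearKernel lam 1 (Hnorm u) < ∞ := by
  set a : ℝ := lam * n / (n + 1) with ha
  set b : ℝ := lam / (2 * n + 2) with hb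
  have hn0 : (0 : ℝ) < n := by exact_mod_cast hn
  have ha0 : 0 ≤ a := by positivity
  have hb0 : 0 ≤ b := by positivity
  have hab : a + 2 * b = lam := by rw [ha, hb]; field_simp
  have ha1 : a < 2 * n := by
    rw [ha, div_lt_iff₀ (by positivity)]; nlinarith
  have hb1 : b < 1 := by
    rw [hb, div_lt_one (by positivity)]; exact hQ
  have hint := (integrable_mul_prod_of_finrank hn (a := a) (m := 2 * n + 1) (b := b) (k := 2)
    ha1 (by linarith) hb1 (by linarith)).const_mul ((2 : ℝ) ^ (2 * n + 1 : ℝ) * 2 ^ (2 : ℝ))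
  refine lt_of_le_of_lt (lintegral_mono_ae ?_) hint.lintegral_lt_top
  filter_upwards [ae_fst_ne_zero hn, ae_snd_ne_zero] with u hu1 hu2
  unfold nearKernel
  by_cases hu : Hnorm u ∈ Set.Iio 1
  swap
  · simp [Set.indicator_of_notMem hu]
  rw [Set.indicator_of_mem hu]
  refine ENNReal.ofReal_le_ofReal ?_
  have hu' : Hnorm u < 1 := hu
  have hz : 0 < ‖u.1‖ := norm_pos_iff.2 hu1
  have ht : 0 < |u.2| := abs_pos.2 hu2
  have hz1 := norm_fst_le_Hnorm u
  have ht1 := abs_snd_le_Hnorm_sq u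
  have hN : 0 < Hnorm u := hz.trans_le hz1
  have ht2 : |u.2| ≤ 1 := ht1.trans (pow_le_one₀ hN.le hu'.le)
  have k1 : Hnorm u ^ (-a) ≤ ‖u.1‖ ^ (-a) :=
    Real.rpow_le_rpow_of_nonpos hz hz1 (by linarith)
  have k2 : (Hnorm u ^ 2) ^ (-b) ≤ |u.2| ^ (-b) :=
    Real.rpow_le_rpow_of_nonpos ht ht1 (by linarith)
  have k3 : (2 : ℝ) ^ (-(2 * n + 1 : ℝ)) ≤ (1 + ‖u.1‖) ^ (-(2 * n + 1 : ℝ)) :=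
    Real.rpow_le_rpow_of_nonpos (by positivity) (by linarith) (by linarith)
  have k4 : (2 : ℝ) ^ (-(2 : ℝ)) ≤ (1 + |u.2|) ^ (-(2 : ℝ)) :=
    Real.rpow_le_rpow_of_nonpos (by positivity) (by linarith) (by linarith)
  have e : (Hnorm u ^ lam)⁻¹ = (2 : ℝ) ^ (2 * n + 1 : ℝ) * 2 ^ (2 : ℝ) *
      ((Hnorm u ^ (-a) * (2 : ℝ) ^ (-(2 * n + 1 : ℝ))) *
        ((Hnorm u ^ 2) ^ (-b) * (2 : ℝ) ^ (-(2 : ℝ)))) := by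
    rw [← Real.rpow_neg hN.le, ← hab, Real.rpow_neg zero_le_two, Real.rpow_neg zero_le_two,
      ← Real.rpow_natCast (Hnorm u), ← Real.rpow_mul hN.le]
    have : Hnorm u ^ (-(a + 2 * b)) = Hnorm u ^ (-a) * Hnorm u ^ (((2 : ℕ) : ℝ) * -b) := by
      rw [← Real.rpow_add hN]; congr 1; push_cast; ring
    rw [this]
    have := (Real.rpow_pos_of_pos (two_pos (α := ℝ)) (2 * n + 1 : ℝ)).ne'
    have := (Real.rpow_pos_of_pos (two_pos (α := ℝ)) (2 : ℝ)).ne'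
    field_simp
  rw [e]
  gcongr

lemma exists_lintegral_nearKernel_le {n : ℕ} (hn : 1 ≤ n) {lam : ℝ} (h0 : 0 < lam)
    (hQ : lam < 2 * n + 2) {η : ℝ≥0∞} (hη : 0 < η) :
    ∃ ε : ℝ, 0 < ε ∧ ε ≤ 1 ∧ ∀ v : Hn n, ∫⁻ u, nearKernel lam ε (Hdist u v) ≤ η := by
  have lim : Tendsto (fun k : ℕ => ∫⁻ u : Hn n, nearKernel lam (1 / ((k : ℝ) + 1)) (Hnorm u))
      atTop (nhds (∫⁻ _ : Hn n, 0)) := by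
    refine tendsto_lintegral_of_dominated_convergence (fun u => nearKernel lam 1 (Hnorm u))
      (fun k => (measurable_nearKernel _ _).comp measurable_Hnorm)
      (fun k => ae_of_all _ fun u => ?_) (lintegral_nearKernel_one_lt_top hn h0 hQ).ne
      (ae_of_all _ fun u => ?_)
    · refine Set.indicator_le_indicator_of_subset (Set.Iio_subset_Iio ?_) (fun _ => zero_le) _
      rw [div_le_one (by positivity)]
      linarith [k.cast_nonneg (α := ℝ)]
    · rcases (Hnorm_nonneg u).eq_or_lt with hu | hu
      · have : ∀ k : ℕ, nearKernel lam (1 / ((k : ℝ) + 1)) (Hnorm u) = 0 := by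
          intro k
          rw [← hu]
          simp [nearKernel, Real.zero_rpow h0.ne']
        simp only [this]
        exact tendsto_const_nhds
      · refine tendsto_const_nhds.congr' ?_
        filter_upwards [(tendsto_one_div_add_atTop_nhds_zero_nat (𝕜 := ℝ)).eventually
          (gt_mem_nhds hu)] with k hk
        refine (Set.indicator_of_notMem ?_ _).symm
        exact not_lt.2 hk.le
  rw [lintegral_zero] at lim
  obtain ⟨k, hk⟩ := (lim.eventually (gt_mem_nhds hη)).exists
  refine ⟨1 / ((k : ℝ) + 1), by positivity, ?_, fun v => ?_⟩
  · rw [div_le_one (by positivity)]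
    linarith [k.cast_nonneg (α := ℝ)]
  · rw [lintegral_comp_Hdist (measurable_nearKernel _ _)]
    exact hk.le

lemma setLIntegral_near_le {n : ℕ} {lam ε R C : ℝ} {m₁ m₂ : ℝ} (hε : ε ≤ 1)
    (hC : ∀ u v : Hn n, u ∈ Metric.closedBall (0 : Hn n) R → Hdist u v < 1 →
      1 ≤ C * decayWeight m₁ m₂ v) {η : ℝ≥0∞}
    (hη : ∀ v : Hn n, ∫⁻ u, nearKernel lam ε (Hdist u v) ≤ η)
    {f : Hn n → ℝ} (hf : Measurable f) :
    ∫⁻ u in Metric.closedBall (0 : Hn n) R, ∫⁻ v, ‖f v‖ₑ * nearKernel lam ε (Hdist u v) ≤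
      η * (ENNReal.ofReal C * ∫⁻ v, ‖f v‖ₑ * ENNReal.ofReal (decayWeight m₁ m₂ v)) := by
  have hk : Measurable fun x : Hn n × Hn n => nearKernel lam ε (Hdist x.1 x.2) :=
    (measurable_nearKernel _ _).comp measurable_Hdist
  have hw := measurable_decayWeight (n := n) m₁ m₂
  rw [lintegral_lintegral_swap, ← lintegral_const_mul _ (by fun_prop),
    ← lintegral_const_mul _ (by fun_prop)]
  · refine lintegral_mono fun v => ?_
    have hkv : Measurable fun u : Hn n => nearKernel lam ε (Hdist u v) :=
      (measurable_nearKernel _ _).comp (measurable_Hdist_left v)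
    calc ∫⁻ u in Metric.closedBall (0 : Hn n) R, ‖f v‖ₑ * nearKernel lam ε (Hdist u v)
        ≤ ∫⁻ u in Metric.closedBall (0 : Hn n) R,
            (‖f v‖ₑ * ENNReal.ofReal (C * decayWeight m₁ m₂ v)) *
              nearKernel lam ε (Hdist u v) := by
          refine setLIntegral_mono (hkv.const_mul _) fun u hu => ?_
          by_cases hd : Hdist u v ∈ Set.Iio ε
          · have h1 : Hdist u v < 1 := lt_of_lt_of_le hd hε
            have h2 : 1 ≤ ENNReal.ofReal (C * decayWeight m₁ m₂ v) :=
              ENNReal.one_le_ofReal.2 (hC u v hu h1)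
            gcongr
            exact le_mul_of_one_le_right zero_le h2
          · simp [nearKernel, Set.indicator_of_notMem hd]
      _ ≤ ∫⁻ u, (‖f v‖ₑ * ENNReal.ofReal (C * decayWeight m₁ m₂ v)) *
              nearKernel lam ε (Hdist u v) := setLIntegral_le_lintegral _ _
      _ ≤ (‖f v‖ₑ * ENNReal.ofReal (C * decayWeight m₁ m₂ v)) * η := by
          rw [lintegral_const_mul _ hkv]
          gcongr
          exact hη v
      _ = _ := by
          rw [ENNReal.ofReal_mul' (decayWeight_pos m₁ m₂ v).le]
          ring
  · refine Measurable.aemeasurable ?_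
    exact (hf.comp measurable_snd).enorm.mul hk

lemma enorm_Ilam_sub_le {n : ℕ} {lam ε : ℝ} {f : Hn n → ℝ} (hf : Measurable f) (u : Hn n)
    (hfar : Integrable fun v => f v * farKernel lam ε (Hdist u v)) :
    ‖Ilam lam f u - ∫ v, f v * farKernel lam ε (Hdist u v)‖ₑ ≤
      ∫⁻ v, ‖f v‖ₑ * nearKernel lam ε (Hdist u v) := by
  by_cases htop : ∫⁻ v, ‖f v‖ₑ * nearKernel lam ε (Hdist u v) = ∞
  · rw [htop]; exact le_top
  set N : Hn n → ℝ := fun v =>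
    f v * (Set.Iio ε).indicator (fun s => (s ^ lam)⁻¹) (Hdist u v) with hN
  have hdu := measurable_Hdist_right u
  have hNm : Measurable N := by
    refine hf.mul (Measurable.comp (Measurable.indicator ?_ measurableSet_Iio) hdu)
    fun_prop
  have hNe : ∀ v, ‖N v‖ₑ = ‖f v‖ₑ * nearKernel lam ε (Hdist u v) := by
    intro v
    rw [hN]
    simp only [enorm_mul]
    congr 1
    by_cases hd : Hdist u v ∈ Set.Iio ε
    · simp only [nearKernel, Set.indicator_of_mem hd]
      exact Real.enorm_of_nonneg (inv_nonneg.2 (Real.rpow_nonneg (Hdist_nonneg u v) _))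
    · simp [nearKernel, Set.indicator_of_notMem hd]
  have hNi : Integrable N :=
    ⟨hNm.aestronglyMeasurable, by
      simp only [HasFiniteIntegral, hNe]; exact lt_top_iff_ne_top.2 htop⟩
  have hsum : Ilam lam f u = (∫ v, N v) + ∫ v, f v * farKernel lam ε (Hdist u v) := by
    rw [← integral_add hNi hfar]
    refine integral_congr_ae (ae_of_all _ fun v => ?_)
    simp only [hN, farKernel, div_eq_mul_inv]
    rw [← mul_add]
    congr 1
    by_cases hd : Hdist u v < ε
    · rw [Set.indicator_of_mem (Set.mem_Iio.2 hd),
        Set.indicator_of_notMem (by simpa using hd), add_zero]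
    · rw [Set.indicator_of_notMem (by simpa using hd),
        Set.indicator_of_mem (Set.mem_Ici.2 (not_lt.1 hd)), zero_add]
  rw [hsum, add_sub_cancel_right]
  refine (enorm_integral_le_lintegral_enorm _).trans (le_of_eq ?_)
  exact lintegral_congr hNe

lemma integrable_mul_of_le_decayWeight {n : ℕ} {m₁ m₂ C : ℝ} {f χ : Hn n → ℝ}
    (hf : Measurable f) (hfin : ∫⁻ v, ‖f v‖ₑ * ENNReal.ofReal (decayWeight m₁ m₂ v) ≠ ∞)
    (hχ : Measurable χ) (hle : ∀ v, |χ v| ≤ C * decayWeight m₁ m₂ v) :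
    Integrable fun v => f v * χ v := by
  have hw := measurable_decayWeight (n := n) m₁ m₂
  have h : Integrable fun v => f v * decayWeight m₁ m₂ v := by
    refine ⟨(hf.mul hw).aestronglyMeasurable, ?_⟩
    rw [HasFiniteIntegral]
    refine lt_of_le_of_lt (le_of_eq ?_) (lt_top_iff_ne_top.2 hfin)
    refine lintegral_congr fun v => ?_
    rw [enorm_mul, Real.enorm_of_nonneg (decayWeight_pos m₁ m₂ v).le]
  refine (h.norm.const_mul C).mono' (hf.mul hχ).aestronglyMeasurable (ae_of_all _ fun v => ?_)
  rw [norm_mul, norm_mul, Real.norm_eq_abs (χ v),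
    Real.norm_of_nonneg (decayWeight_pos m₁ m₂ v).le]
  calc ‖f v‖ * |χ v| ≤ ‖f v‖ * (C * decayWeight m₁ m₂ v) := by gcongr; exact hle v
    _ = _ := by ring

lemma exists_abs_farKernel_le {n : ℕ} {m₁ m₂ lam : ℝ} (h₁ : 0 ≤ m₁) (h₂ : 0 ≤ m₂)
    (hm : m₁ + 2 * m₂ = lam) (u : Hn n) {ε : ℝ} (hε : 0 < ε) :
    ∃ C : ℝ, ∀ v, |farKernel lam ε (Hdist u v)| ≤ C * decayWeight m₁ m₂ v := by
  obtain ⟨C, hC⟩ := exists_inv_Hdist_rpow_le h₁ h₂ hm u hε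
  refine ⟨|C|, fun v => ?_⟩
  by_cases hd : ε ≤ Hdist u v
  · rw [farKernel, Set.indicator_of_mem (Set.mem_Ici.2 hd),
      abs_of_nonneg (inv_nonneg.2 (Real.rpow_nonneg (Hdist_nonneg u v) _))]
    refine (hC v hd).trans ?_
    have := (decayWeight_pos m₁ m₂ v).le
    gcongr
    exact le_abs_self C
  · rw [farKernel, Set.indicator_of_notMem (by simpa using hd), abs_zero]
    have := (decayWeight_pos m₁ m₂ v).le
    positivity

lemma measurable_lintegral_near {n : ℕ} (lam ε : ℝ) {f : Hn n → ℝ} (hf : Measurable f) :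
    Measurable fun u : Hn n => ∫⁻ v, ‖f v‖ₑ * nearKernel lam ε (Hdist u v) := by
  have h : Measurable (Function.uncurry fun u v : Hn n =>
      ‖f v‖ₑ * nearKernel lam ε (Hdist u v)) :=
    (hf.comp measurable_snd).enorm.mul ((measurable_nearKernel _ _).comp measurable_Hdist)
  exact h.lintegral_prod_right

lemma stronglyMeasurable_integral_far {n : ℕ} (lam ε : ℝ) {f : Hn n → ℝ} (hf : Measurable f) :
    StronglyMeasurable fun u : Hn n => ∫ v, f v * farKernel lam ε (Hdist u v) := by
  have h : Measurable (Function.uncurry fun u v : Hn n =>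
      f v * farKernel lam ε (Hdist u v)) :=
    (hf.comp measurable_snd).mul ((measurable_farKernel _ _).comp measurable_Hdist)
  exact h.stronglyMeasurable.integral_prod_right

lemma exists_volume_near_ge_le {n : ℕ} (hn : 1 ≤ n) {m₁ m₂ lam : ℝ} (h₁ : 0 ≤ m₁) (h₂ : 0 ≤ m₂)
    (h0 : 0 < lam) (hQ : lam < 2 * n + 2)
    (M : ℝ≥0∞) (hM : M ≠ ∞) (R : ℝ) {δ : ℝ≥0∞} (hδ : 0 < δ) (hδ' : δ ≠ ∞) :
    ∃ ε : ℝ, 0 < ε ∧ ∀ f : Hn n → ℝ, Measurable f →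
      ∫⁻ v, ‖f v‖ₑ * ENNReal.ofReal (decayWeight m₁ m₂ v) ≤ M →
      volume.restrict (Metric.closedBall (0 : Hn n) R)
        {u | δ ≤ ∫⁻ v, ‖f v‖ₑ * nearKernel lam ε (Hdist u v)} ≤ δ := by
  obtain ⟨C, -, hC⟩ := exists_one_le_mul_decayWeight (n := n) h₁ h₂ R
  set K : ℝ≥0∞ := ENNReal.ofReal C * M + 1 with hK
  have hK' : K ≠ ∞ := by finiteness
  have hK0 : K ≠ 0 := by simp [hK]
  obtain ⟨ε, hε0, hε1, hε⟩ := exists_lintegral_nearKernel_le hn h0 hQ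
    (η := δ * δ / K) (ENNReal.div_pos (ENNReal.mul_pos hδ.ne' hδ.ne').ne' hK')
  refine ⟨ε, hε0, fun f hf hfM => ?_⟩
  have h := (mul_meas_ge_le_lintegral (μ := volume.restrict (Metric.closedBall (0 : Hn n) R))
    (measurable_lintegral_near lam ε hf) δ).trans (setLIntegral_near_le hε1 hC hε hf)
  have h' : δ * volume.restrict (Metric.closedBall (0 : Hn n) R)
      {u | δ ≤ ∫⁻ v, ‖f v‖ₑ * nearKernel lam ε (Hdist u v)} ≤ δ * δ := by
    refine h.trans ?_
    calc δ * δ / K * (ENNReal.ofReal C *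
            ∫⁻ v, ‖f v‖ₑ * ENNReal.ofReal (decayWeight m₁ m₂ v))
        ≤ δ * δ / K * K := by
          gcongr
          exact (mul_le_mul_right hfM _).trans le_self_add
      _ = δ * δ := ENNReal.div_mul_cancel hK0 hK'
  exact (ENNReal.mul_le_mul_iff_right hδ.ne' hδ').1 h'

lemma eventually_volume_Ilam_sub_ge_le {n : ℕ} (hn : 1 ≤ n) {m₁ m₂ lam : ℝ} (h₁ : 0 ≤ m₁)
    (h₂ : 0 ≤ m₂) (hm : m₁ + 2 * m₂ = lam) (h0 : 0 < lam) (hQ : lam < 2 * n + 2)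
    {f : ℕ → Hn n → ℝ} {f₀ : Hn n → ℝ} (hf : ∀ i, Measurable (f i)) (hf₀ : Measurable f₀)
    {M : ℝ≥0∞} (hM : M ≠ ∞)
    (hfM : ∀ i, ∫⁻ v, ‖f i v‖ₑ * ENNReal.ofReal (decayWeight m₁ m₂ v) ≤ M)
    (hf₀M : ∫⁻ v, ‖f₀ v‖ₑ * ENNReal.ofReal (decayWeight m₁ m₂ v) ≤ M)
    (hlim : ∀ χ : Hn n → ℝ, ∀ C : ℝ, Measurable χ → (∀ v, |χ v| ≤ C * decayWeight m₁ m₂ v) →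
      Tendsto (fun i => ∫ v, f i v * χ v) atTop (nhds (∫ v, f₀ v * χ v)))
    (R : ℝ) {δ : ℝ≥0∞} (hδ : 0 < δ) (hδ' : δ ≠ ∞) :
    ∀ᶠ i in atTop, volume.restrict (Metric.closedBall (0 : Hn n) R)
      {u | 3 * δ ≤ ‖Ilam lam (f i) u - Ilam lam f₀ u‖ₑ} ≤ 3 * δ := by
  obtain ⟨ε, hε, hnear⟩ := exists_volume_near_ge_le hn h₁ h₂ h0 hQ M hM R hδ hδ'
  have : IsFiniteMeasure (volume.restrict (Metric.closedBall (0 : Hn n) R)) :=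
    ⟨by simpa using measure_closedBall_lt_top⟩
  have hmf : ∀ u : Hn n, Measurable fun v => farKernel lam ε (Hdist u v) :=
    fun u => (measurable_farKernel _ _).comp (measurable_Hdist_right u)
  have hfar : ∀ u : Hn n, Tendsto (fun i => ∫ v, f i v * farKernel lam ε (Hdist u v)) atTop
      (nhds (∫ v, f₀ v * farKernel lam ε (Hdist u v))) := fun u => by
    obtain ⟨C, hC⟩ := exists_abs_farKernel_le h₁ h₂ hm u hε
    exact hlim _ C (hmf u) hC
  have hint : ∀ h : Hn n → ℝ, Measurable h →
      ∫⁻ v, ‖h v‖ₑ * ENNReal.ofReal (decayWeight m₁ m₂ v) ≤ M → ∀ u,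
      Integrable fun v => h v * farKernel lam ε (Hdist u v) := fun h hh hhM u => by
    obtain ⟨C, hC⟩ := exists_abs_farKernel_le h₁ h₂ hm u hε
    exact integrable_mul_of_le_decayWeight hh (ne_top_of_le_ne_top hM hhM) (hmf u) hC
  have hmeas := tendstoInMeasure_of_tendsto_ae
    (μ := volume.restrict (Metric.closedBall (0 : Hn n) R))
    (fun i => (stronglyMeasurable_integral_far lam ε (hf i)).aestronglyMeasurable)
    (ae_of_all _ hfar)
  filter_upwards [(hmeas δ hδ).eventually (ge_mem_nhds hδ)] with i hi
  refine (measure_mono (t := ({u | δ ≤ ∫⁻ v, ‖f i v‖ₑ * nearKernel lam ε (Hdist u v)} ∪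
    {u | δ ≤ ∫⁻ v, ‖f₀ v‖ₑ * nearKernel lam ε (Hdist u v)}) ∪
    {u | δ ≤ edist (∫ v, f i v * farKernel lam ε (Hdist u v))
      (∫ v, f₀ v * farKernel lam ε (Hdist u v))}) fun u hu => ?_).trans ?_
  · by_contra hcon
    simp only [Set.mem_union, Set.mem_ofPred_eq, not_or, not_le] at hcon hu
    obtain ⟨⟨c1, c2⟩, c3⟩ := hcon
    have e1 := (enorm_Ilam_sub_le (hf i) u (hint _ (hf i) (hfM i) u)).trans_lt c1
    have e2 := (enorm_Ilam_sub_le hf₀ u (hint _ hf₀ hf₀M u)).trans_lt c2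
    rw [edist_eq_enorm_sub] at c3
    set A := ∫ v, f i v * farKernel lam ε (Hdist u v)
    set B := ∫ v, f₀ v * farKernel lam ε (Hdist u v)
    have e4 : Ilam lam (f i) u - Ilam lam f₀ u =
        (Ilam lam (f i) u - A) + (A - B) - (Ilam lam f₀ u - B) := by ring
    have : ‖Ilam lam (f i) u - Ilam lam f₀ u‖ₑ < δ + δ + δ := by
      rw [e4]
      refine (enorm_sub_le).trans_lt ?_
      refine (add_le_add_left (enorm_add_le _ _) _).trans_lt ?_
      exact ENNReal.add_lt_add (ENNReal.add_lt_add e1 c3) e2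
    have e5 : 3 * δ = δ + δ + δ := by ring
    rw [e5] at hu
    exact absurd this (not_lt.2 hu)
  · refine (measure_union_le _ _).trans ((add_le_add (measure_union_le _ _) le_rfl).trans ?_)
    have e5 : 3 * δ = δ + δ + δ := by ring
    rw [e5]
    exact add_le_add (add_le_add (hnear _ (hf i) (hfM i)) (hnear _ hf₀ hf₀M)) hi

lemma exists_subseq_ae_tendsto_of_locally_in_measure {n : ℕ} {F : ℕ → Hn n → ℝ} {F₀ : Hn n → ℝ}
    (h : ∀ (R : ℝ) (δ : ℝ≥0∞), 0 < δ → δ ≠ ∞ → ∀ᶠ i in atTop,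
      volume.restrict (Metric.closedBall (0 : Hn n) R) {u | δ ≤ ‖F i u - F₀ u‖ₑ} ≤ δ) :
    ∃ ψ : ℕ → ℕ, StrictMono ψ ∧
      ∀ᵐ u, Tendsto (fun i => F (ψ i) u) atTop (nhds (F₀ u)) := by
  obtain ⟨ψ, hψ, hP⟩ := extraction_forall_of_eventually (fun k : ℕ =>
    h k ((2 : ℝ≥0∞)⁻¹ ^ k) (ENNReal.pow_pos (by simp) k) (by finiteness))
  refine ⟨ψ, hψ, ?_⟩
  have hsum : ∑' k : ℕ, volume ({u | (2 : ℝ≥0∞)⁻¹ ^ k ≤ ‖F (ψ k) u - F₀ u‖ₑ} ∩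
      Metric.closedBall (0 : Hn n) k) ≠ ∞ := by
    refine ne_top_of_le_ne_top (b := ∑' k : ℕ, (2 : ℝ≥0∞)⁻¹ ^ k) ?_
      (ENNReal.tsum_le_tsum fun k => ?_)
    · rw [ENNReal.tsum_geometric]; simp
    · rw [← Measure.restrict_apply' measurableSet_closedBall (μ := volume)]
      exact hP k
  filter_upwards [ae_eventually_notMem hsum] with u hu
  rw [tendsto_iff_edist_tendsto_0]
  have hz : Tendsto (fun k : ℕ => (2 : ℝ≥0∞)⁻¹ ^ k) atTop (nhds 0) :=
    ENNReal.tendsto_pow_atTop_nhds_zero_of_lt_one (by simp)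
  refine tendsto_of_tendsto_of_tendsto_of_le_of_le' tendsto_const_nhds hz
    (Eventually.of_forall fun _ => zero_le) ?_
  obtain ⟨N, hN⟩ := exists_nat_ge ‖u‖
  filter_upwards [hu, eventually_ge_atTop N] with k hk hkN
  have hmem : u ∈ Metric.closedBall (0 : Hn n) k := by
    rw [mem_closedBall_zero_iff]
    exact hN.trans (by exact_mod_cast hkN)
  rw [edist_eq_enorm_sub]
  by_contra hcon
  exact hk ⟨(not_le.1 hcon).le, hmem⟩

/-- If `f` is almost everywhere strongly measurable and all its pairings with `L^r` functions
vanish, then `f` vanishes almost everywhere. -/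
lemma ae_eq_zero_of_forall_integral_memLp_eq_zero {X : Type*} [MeasurableSpace X] {μ : Measure X}
    [SigmaFinite μ] {r : ℝ≥0∞} {f : X → ℝ} (hf : AEStronglyMeasurable f μ)
    (h : ∀ φ : X → ℝ, MemLp φ r μ → ∫ x, f x * φ x ∂μ = 0) : f =ᵐ[μ] 0 := by
  set f' := hf.mk f with hf'
  have hfm : Measurable f' := hf.stronglyMeasurable_mk.measurable
  let A : ℕ → Set X := fun k => {x | |f' x| ≤ k} ∩ spanningSets μ k
  have hA : ∀ k, MeasurableSet (A k) := fun k =>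
    (measurableSet_le hfm.abs measurable_const).inter (measurableSet_spanningSets μ k)
  have hAfin : ∀ k, μ (A k) < ∞ := fun k =>
    (measure_mono Set.inter_subset_right).trans_lt (measure_spanningSets_lt_top μ k)
  have hbd : ∀ k x, x ∈ A k → |f' x| ≤ k := fun k x hx => hx.1
  have hk : ∀ k, ∀ᵐ x ∂μ, x ∈ A k → f' x = 0 := by
    intro k
    have : IsFiniteMeasure (μ.restrict (A k)) := ⟨by simpa using hAfin k⟩
    have hmem : MemLp ((A k).indicator f') r μ := by
      rw [memLp_indicator_iff_restrict (hA k)]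
      exact MemLp.of_bound hfm.aestronglyMeasurable k
        (ae_restrict_of_forall_mem (hA k) fun x hx => hbd k x hx)
    have h0 : ∫ x in A k, f' x * f' x ∂μ = 0 := by
      rw [← h _ hmem, ← integral_indicator (hA k)]
      refine integral_congr_ae ?_
      filter_upwards [hf.ae_eq_mk] with x hx
      rw [hx, ← hf']
      by_cases hxA : x ∈ A k <;> simp [hxA]
    have hint : Integrable (fun x => f' x * f' x) (μ.restrict (A k)) := by
      refine Integrable.of_bound (hfm.mul hfm).aestronglyMeasurable ((k : ℝ) * k)
        (ae_restrict_of_forall_mem (hA k) fun x hx => ?_)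
      rw [norm_mul, Real.norm_eq_abs]
      have := hbd k x hx
      gcongr
    have := (integral_eq_zero_iff_of_nonneg (fun x => mul_self_nonneg (f' x)) hint).1 h0
    filter_upwards [(ae_restrict_iff' (hA k)).1 this] with x hx hxA
    exact mul_self_eq_zero.1 (hx hxA)
  filter_upwards [hf.ae_eq_mk, ae_all_iff.2 hk] with x hx hx0
  rw [hx]
  obtain ⟨N₁, hN₁⟩ := exists_nat_ge |f' x|
  obtain ⟨N₂, hN₂⟩ := Set.mem_iUnion.1
    ((iUnion_spanningSets μ).symm ▸ Set.mem_univ x : x ∈ ⋃ i, spanningSets μ i)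
  refine hx0 (max N₁ N₂) ⟨?_, monotone_spanningSets μ (le_max_right _ _) hN₂⟩
  exact hN₁.trans (by exact_mod_cast le_max_left _ _)

/-- A function representing (through the Bochner integral) the limit of a sequence of integrable
pairings on `L^r` either pairs integrably with all of `L^r`, or represents the zero functional
and fails to be measurable. -/
lemma integrable_or_not_aestronglyMeasurable_of_tendsto {X : Type*} [MeasurableSpace X]
    {μ : Measure X} [SigmaFinite μ] {r : ℝ≥0∞} {S : ℕ → X → ℝ} {f : X → ℝ}
    (hS : ∀ i, ∀ φ : X → ℝ, MemLp φ r μ → Integrable (fun x => S i x * φ x) μ)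
    (hlim : ∀ φ : X → ℝ, MemLp φ r μ →
      Tendsto (fun i => ∫ x, S i x * φ x ∂μ) atTop (nhds (∫ x, f x * φ x ∂μ))) :
    (∀ φ : X → ℝ, MemLp φ r μ → Integrable (fun x => f x * φ x) μ) ∨
      (¬ AEStronglyMeasurable f μ ∧ ∀ φ : X → ℝ, MemLp φ r μ → ∫ x, f x * φ x ∂μ = 0) := by
  by_cases h : ∀ φ : X → ℝ, MemLp φ r μ → ∫ x, f x * φ x ∂μ = 0
  · by_cases hf : AEStronglyMeasurable f μ
    · left
      intro φ _
      refine (integrable_zero X ℝ μ).congr ?_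
      filter_upwards [ae_eq_zero_of_forall_integral_memLp_eq_zero hf h] with x hx
      simp [hx]
    · exact Or.inr ⟨hf, h⟩
  · left
    push Not at h
    obtain ⟨φ₀, hφ₀, hne⟩ := h
    intro φ hφ
    by_contra hnot
    have hi₀ : Integrable (fun x => f x * φ₀ x) μ := by
      by_contra hc
      exact hne (integral_undef hc)
    have hsum : ¬ Integrable (fun x => f x * (φ x + φ₀ x)) μ := fun hc => by
      refine hnot ((hc.sub hi₀).congr (ae_of_all _ fun x => ?_))
      simp only [Pi.sub_apply]; ring
    have l1 := hlim φ hφ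
    have l2 := hlim φ₀ hφ₀
    have l3 := hlim (fun x => φ x + φ₀ x) (hφ.add hφ₀)
    rw [integral_undef hnot] at l1
    rw [integral_undef hsum] at l3
    have l4 := l1.add l2
    have e : ∀ i, (∫ x, S i x * φ x ∂μ) + ∫ x, S i x * φ₀ x ∂μ
        = ∫ x, S i x * (φ x + φ₀ x) ∂μ := fun i => by
      rw [← integral_add (hS i φ hφ) (hS i φ₀ hφ₀)]
      simp only [mul_add]
    simp only [e, zero_add] at l4
    exact hne (tendsto_nhds_unique l4 l3)

lemma Ilam_congr_ae {n : ℕ} {lam : ℝ} {f g : Hn n → ℝ} (h : f =ᵐ[volume] g) :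
    Ilam lam f = Ilam lam g := by
  funext u
  refine integral_congr_ae ?_
  filter_upwards [h] with v hv
  rw [hv]

lemma ae_Hdist_pos {n : ℕ} (hn : 1 ≤ n) (u : Hn n) : ∀ᵐ v, 0 < Hdist u v := by
  have : Nonempty (Fin n) := ⟨⟨0, hn⟩⟩
  have h : ∀ᵐ v : Hn n, v.1 ≠ u.1 := by
    rw [Measure.volume_eq_prod]
    exact Measure.quasiMeasurePreserving_fst.ae (p := fun z : Fin n → ℂ => z ≠ u.1)
      (Measure.ae_ne _ _)
  filter_upwards [h] with v hv
  have h1 : ‖-u.1 + v.1‖ ≤ Hdist u v := norm_fst_le_Hnorm (Hmul (Hinv u) v)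
  refine lt_of_lt_of_le (norm_pos_iff.2 fun h0 => hv ?_) h1
  rw [neg_add_eq_zero] at h0
  exact h0.symm

lemma Ilam_eq_zero_of_not_aestronglyMeasurable {n : ℕ} (hn : 1 ≤ n) {lam : ℝ} {f : Hn n → ℝ}
    (hf : ¬ AEStronglyMeasurable f volume) (u : Hn n) : Ilam lam f u = 0 := by
  refine integral_undef fun hi => hf ?_
  have hm : Measurable fun v => Hdist u v ^ lam := (measurable_Hdist_right u).pow_const lam
  refine (hi.aestronglyMeasurable.mul hm.aestronglyMeasurable).congr ?_
  filter_upwards [ae_Hdist_pos hn u] with v hv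
  have := (Real.rpow_pos_of_pos hv lam).ne'
  simp only [Pi.mul_apply]
  field_simp

/-- A splitting of the decay rate between the horizontal and the vertical variables which makes
the weighted kernel integrable to the power `p'` away from its singularity. -/
lemma exists_decay_exponents {n p p' q q' lam α β : ℝ} (hn : 0 < n) (hp : 1 < p) (hq' : 1 < q')
    (hq : 1 / q + 1 / q' = 1) (hp' : 1 / p + 1 / p' = 1)
    (hβ : β < 2 * n / p') (hα : α < 2 * n / q)
    (hbal : 1 / p + 1 / q' + (lam + α + β) / (2 * n + 2) = 2) :
    1 < p' ∧ ∃ m₁ m₂ : ℝ, 0 ≤ m₁ ∧ 0 ≤ m₂ ∧ m₁ + 2 * m₂ = lam ∧ p' * β < 2 * n ∧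
      2 * n < p' * β + p' * m₁ ∧ 1 < p' * m₂ := by
  have hip : 1 / p < 1 := by rw [div_lt_one (by linarith)]; exact hp
  have hip0 : 0 < 1 / p := by positivity
  have hiq : 1 / q' < 1 := by rw [div_lt_one (by linarith)]; exact hq'
  have hx0 : 0 < 1 / p' := by linarith
  have hp0 : 0 < p' := one_div_pos.1 hx0
  have hp1 : 1 < p' := by
    have : 1 / p' < 1 := by linarith
    rwa [div_lt_one hp0] at this
  have hy0 : 0 < 1 / q := by linarith
  have hb1 : (lam + α + β) / (2 * n + 2) = 1 / p' + 1 / q := by linarith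
  rw [div_eq_iff (by positivity)] at hb1
  have hα' : α < 2 * n * (1 / q) := by rwa [mul_one_div]
  have hβ' : β < 2 * n * (1 / p') := by rwa [mul_one_div]
  set x := 1 / p' with hx
  set y := 1 / q
  have hpx : p' * x = 1 := by rw [hx]; field_simp
  set s := lam + β - (2 * n + 2) * x with hs
  have hs0 : 0 < s := by nlinarith
  refine ⟨hp1, 2 * n * x - β + s / 2, x + s / 4, by linarith, by linarith, by rw [hs]; ring,
    ?_, ?_, ?_⟩
  · have := mul_lt_mul_of_pos_left hβ' hp0
    calc p' * β < p' * (2 * n * x) := this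
      _ = 2 * n * (p' * x) := by ring
      _ = 2 * n := by rw [hpx, mul_one]
  · have e : p' * β + p' * (2 * n * x - β + s / 2) = 2 * n * (p' * x) + p' * s / 2 := by ring
    rw [e, hpx]
    have := mul_pos hp0 hs0
    linarith
  · have e : p' * (x + s / 4) = p' * x + p' * s / 4 := by ring
    rw [e, hpx]
    have := mul_pos hp0 hs0
    linarith

lemma exists_subseq_ae_tendsto_Ilam_of_measurable {n : ℕ} (hn : 1 ≤ n) {m₁ m₂ lam : ℝ}
    (h₁ : 0 ≤ m₁) (h₂ : 0 ≤ m₂) (hm : m₁ + 2 * m₂ = lam) (h0 : 0 < lam) (hQ : lam < 2 * n + 2)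
    {f : ℕ → Hn n → ℝ} {f₀ : Hn n → ℝ} (hf : ∀ i, Measurable (f i)) (hf₀ : Measurable f₀)
    {M : ℝ≥0∞} (hM : M ≠ ∞)
    (hfM : ∀ i, ∫⁻ v, ‖f i v‖ₑ * ENNReal.ofReal (decayWeight m₁ m₂ v) ≤ M)
    (hf₀M : ∫⁻ v, ‖f₀ v‖ₑ * ENNReal.ofReal (decayWeight m₁ m₂ v) ≤ M)
    (hlim : ∀ χ : Hn n → ℝ, ∀ C : ℝ, Measurable χ → (∀ v, |χ v| ≤ C * decayWeight m₁ m₂ v) →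
      Tendsto (fun i => ∫ v, f i v * χ v) atTop (nhds (∫ v, f₀ v * χ v))) :
    ∃ ψ : ℕ → ℕ, StrictMono ψ ∧
      ∀ᵐ u, Tendsto (fun i => Ilam lam (f (ψ i)) u) atTop (nhds (Ilam lam f₀ u)) := by
  refine exists_subseq_ae_tendsto_of_locally_in_measure (F := fun i => Ilam lam (f i))
    (F₀ := Ilam lam f₀) fun R δ hδ hδ' => ?_
  have h3 : 3 * (δ / 3) = δ := ENNReal.mul_div_cancel (by norm_num) (by norm_num)
  have key := eventually_volume_Ilam_sub_ge_le hn h₁ h₂ hm h0 hQ hf hf₀ hM hfM hf₀M hlim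
    R (δ := δ / 3) (ENNReal.div_pos hδ.ne' (by norm_num)) (by finiteness)
  rw [h3] at key
  exact key

lemma exists_subseq_ae_tendsto_Ilam {n : ℕ} (hn : 1 ≤ n) {m₁ m₂ lam : ℝ} (h₁ : 0 ≤ m₁)
    (h₂ : 0 ≤ m₂) (hm : m₁ + 2 * m₂ = lam) (h0 : 0 < lam) (hQ : lam < 2 * n + 2)
    {f : ℕ → Hn n → ℝ} {f₀ : Hn n → ℝ} (hf : ∀ i, Measurable (f i))
    (hf₀ : Integrable fun v => f₀ v * decayWeight m₁ m₂ v)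
    {M : ℝ≥0∞} (hM : M ≠ ∞)
    (hfM : ∀ i, ∫⁻ v, ‖f i v‖ₑ * ENNReal.ofReal (decayWeight m₁ m₂ v) ≤ M)
    (hlim : ∀ χ : Hn n → ℝ, ∀ C : ℝ, Measurable χ → (∀ v, |χ v| ≤ C * decayWeight m₁ m₂ v) →
      Tendsto (fun i => ∫ v, f i v * χ v) atTop (nhds (∫ v, f₀ v * χ v))) :
    ∃ ψ : ℕ → ℕ, StrictMono ψ ∧
      ∀ᵐ u, Tendsto (fun i => Ilam lam (f (ψ i)) u) atTop (nhds (Ilam lam f₀ u)) := by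
  have hw := measurable_decayWeight (n := n) m₁ m₂
  have hae : AEStronglyMeasurable f₀ volume := by
    refine (hf₀.aestronglyMeasurable.mul hw.inv.aestronglyMeasurable).congr
      (ae_of_all _ fun v => ?_)
    have := (decayWeight_pos m₁ m₂ v).ne'
    simp only [Pi.mul_apply, Pi.inv_apply]
    field_simp
  obtain ⟨f₁, hf₁m, hmk⟩ : ∃ f₁, Measurable f₁ ∧ f₀ =ᵐ[volume] f₁ :=
    ⟨hae.mk f₀, hae.stronglyMeasurable_mk.measurable, hae.ae_eq_mk⟩
  rw [Ilam_congr_ae hmk]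
  have hfin : ∫⁻ v, ‖f₁ v‖ₑ * ENNReal.ofReal (decayWeight m₁ m₂ v) ≠ ∞ := by
    refine ne_top_of_le_ne_top hf₀.hasFiniteIntegral.ne (le_of_eq (lintegral_congr_ae ?_))
    filter_upwards [hmk] with v hv
    rw [enorm_mul, hv, Real.enorm_of_nonneg (decayWeight_pos m₁ m₂ v).le]
  refine exists_subseq_ae_tendsto_Ilam_of_measurable hn h₁ h₂ hm h0 hQ hf hf₁m
    (M := M + ∫⁻ v, ‖f₁ v‖ₑ * ENNReal.ofReal (decayWeight m₁ m₂ v))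
    (ENNReal.add_ne_top.2 ⟨hM, hfin⟩) (fun i => (hfM i).trans le_self_add) le_add_self
    fun χ C hχ hle => ?_
  have e : ∫ v, f₀ v * χ v = ∫ v, f₁ v * χ v := by
    refine integral_congr_ae ?_
    filter_upwards [hmk] with v hv
    rw [hv]
  rw [← e]
  exact hlim χ C hχ hle

/-- **Almost-everywhere convergence of the horizontally-weighted potentials along a tight
maximizing sequence** (Lemma 3.3). -/
theorem weighted_potential_ae_convergence_horizontal
    (n : ℕ) (hn : 1 ≤ n) (Q p p' q q' lam α β : ℝ) (hQ : Q = 2 * n + 2)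
    (hp : 1 < p) (hq' : 1 < q')
    (hq : 1 / q + 1 / q' = 1) (hp' : 1 / p + 1 / p' = 1)
    (hlam0 : 0 < lam) (hlamQ : lam < Q)
    (hab : 0 ≤ α + β) (habQ : lam + α + β ≤ Q)
    (hβ : β < 2 * n / p') (hα : α < 2 * n / q)
    (hbal : 1 / p + 1 / q' + (lam + α + β) / Q = 2)
    (g : ℕ → Hn n → ℝ) (g₀ : Hn n → ℝ)
    (hmeas : ∀ i, Measurable (g i)) (hpos : ∀ i v, 0 ≤ g i v)
    (hnorm : ∀ i, eLpNorm (fun v => g i v * znorm v.1 ^ β) (ENNReal.ofReal p) volume = 1)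
    (htight : ∀ δ : ℝ, 0 < δ → ∃ R : ℝ, 0 < R ∧ ∀ i,
      1 - ENNReal.ofReal δ ≤
        ∫⁻ v in Hball (0 : Hn n) R, ENNReal.ofReal (|g i v| ^ p * znorm v.1 ^ (β * p)))
    (hweak : ∀ φ : Hn n → ℝ, MemLp φ (ENNReal.ofReal p') volume →
      Tendsto (fun i => ∫ v, g i v * znorm v.1 ^ β * φ v) atTop
        (nhds (∫ v, g₀ v * znorm v.1 ^ β * φ v))) :
    ∃ ψ : ℕ → ℕ, StrictMono ψ ∧
      ∀ᵐ u, Tendsto (fun i => Ilam lam (g (ψ i)) u * znorm u.1 ^ (-α)) atTop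
        (nhds (Ilam lam g₀ u * znorm u.1 ^ (-α))) := by
  subst hQ
  obtain ⟨hp1, m₁, m₂, h₁, h₂, hm, hb0, hb1, hb2⟩ := exists_decay_exponents
    (by exact_mod_cast hn) hp hq' hq hp' hβ hα hbal
  have hp0 : 0 < p' := one_pos.trans hp1
  set r := ENNReal.ofReal p' with hr
  have hconj : ENNReal.HolderConjugate (ENNReal.ofReal p) r :=
    Real.HolderConjugate.ennrealOfReal
      (Real.holderConjugate_iff.2 ⟨hp, by simpa only [one_div] using hp'⟩)
  have hzm := measurable_znorm (n := n)
  have hwm := measurable_decayWeight (n := n) m₁ m₂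
  have hSm : ∀ i, Measurable fun v : Hn n => g i v * znorm v.1 ^ β := fun i =>
    (hmeas i).mul ((hzm.comp measurable_fst).pow_const β)
  have hS : ∀ i, MemLp (fun v : Hn n => g i v * znorm v.1 ^ β) (ENNReal.ofReal p) volume :=
    fun i => ⟨(hSm i).aestronglyMeasurable, by rw [hnorm i]; exact one_lt_top⟩
  have hSφ : ∀ i, ∀ φ : Hn n → ℝ, MemLp φ r volume →
      Integrable fun v => g i v * znorm v.1 ^ β * φ v := fun i φ hφ => (hS i).integrable_mul hφ
  have hW := memLp_znorm_rpow_mul_decayWeight hn hp0 hb0 hb1 hb2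
  set W : Hn n → ℝ := fun v => znorm v.1 ^ (-β) * decayWeight m₁ m₂ v with hWdef
  have hcancel : ∀ f χ : Hn n → ℝ, (fun v : Hn n => f v * znorm v.1 ^ β * (znorm v.1 ^ (-β) * χ v))
      =ᵐ[volume] fun v => f v * χ v := fun f χ => by
    filter_upwards [ae_fst_ne_zero hn] with v hv
    have hz := znorm_pos hv
    have : znorm v.1 ^ β * znorm v.1 ^ (-β) = 1 := by
      rw [← Real.rpow_add hz, add_neg_cancel, Real.rpow_zero]
    calc f v * znorm v.1 ^ β * (znorm v.1 ^ (-β) * χ v)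
        = f v * (znorm v.1 ^ β * znorm v.1 ^ (-β)) * χ v := by ring
      _ = f v * χ v := by rw [this, mul_one]
  have hgM : ∀ i, ∫⁻ v, ‖g i v‖ₑ * ENNReal.ofReal (decayWeight m₁ m₂ v) ≤
      eLpNorm W r volume := fun i => by
    calc ∫⁻ v, ‖g i v‖ₑ * ENNReal.ofReal (decayWeight m₁ m₂ v)
        = eLpNorm ((fun v : Hn n => g i v * znorm v.1 ^ β) • W) 1 volume := by
          rw [eLpNorm_one_eq_lintegral_enorm]
          refine lintegral_congr_ae ?_
          filter_upwards [hcancel (g i) (decayWeight m₁ m₂)] with v hv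
          rw [Pi.smul_apply', smul_eq_mul, hv, enorm_mul,
            Real.enorm_of_nonneg (decayWeight_pos m₁ m₂ v).le]
      _ ≤ eLpNorm (fun v : Hn n => g i v * znorm v.1 ^ β) (ENNReal.ofReal p) volume *
            eLpNorm W r volume :=
          eLpNorm_smul_le_mul_eLpNorm hW.aestronglyMeasurable (hSm i).aestronglyMeasurable
      _ = eLpNorm W r volume := by rw [hnorm i, one_mul]
  have htest : ∀ χ : Hn n → ℝ, ∀ C : ℝ, Measurable χ →
      (∀ v, |χ v| ≤ C * decayWeight m₁ m₂ v) →
      MemLp (fun v : Hn n => znorm v.1 ^ (-β) * χ v) r volume := fun χ C hχ hle => by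
    refine hW.of_le_mul (c := C)
      (((hzm.comp measurable_fst).pow_const (-β)).mul hχ).aestronglyMeasurable
      (ae_of_all _ fun v => ?_)
    have hz := Real.rpow_nonneg (znorm_nonneg v.1) (-β)
    rw [norm_mul, norm_mul, Real.norm_of_nonneg hz, Real.norm_eq_abs (χ v),
      Real.norm_of_nonneg (decayWeight_pos m₁ m₂ v).le]
    calc znorm v.1 ^ (-β) * |χ v| ≤ znorm v.1 ^ (-β) * (C * decayWeight m₁ m₂ v) := by
          gcongr; exact hle v
      _ = _ := by ring
  have hpair : ∀ χ : Hn n → ℝ, ∀ C : ℝ, Measurable χ →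
      (∀ v, |χ v| ≤ C * decayWeight m₁ m₂ v) → Tendsto (fun i => ∫ v, g i v * χ v) atTop
        (nhds (∫ v, g₀ v * znorm v.1 ^ β * (znorm v.1 ^ (-β) * χ v))) := fun χ C hχ hle =>
    (hweak _ (htest χ C hχ hle)).congr fun i => integral_congr_ae (hcancel (g i) χ)
  suffices h : ∃ ψ : ℕ → ℕ, StrictMono ψ ∧
      ∀ᵐ u, Tendsto (fun i => Ilam lam (g (ψ i)) u) atTop (nhds (Ilam lam g₀ u)) by
    obtain ⟨ψ, hψ, hψu⟩ := h
    refine ⟨ψ, hψ, ?_⟩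
    filter_upwards [hψu] with u hu
    exact hu.mul_const _
  rcases integrable_or_not_aestronglyMeasurable_of_tendsto hSφ hweak with hint | ⟨hnot, hzero⟩
  · refine exists_subseq_ae_tendsto_Ilam hn h₁ h₂ hm hlam0 hlamQ hmeas
      ((hint W hW).congr (hcancel g₀ _)) hW.eLpNorm_ne_top hgM fun χ C hχ hle => ?_
    rw [← integral_congr_ae (hcancel g₀ χ)]
    exact hpair χ C hχ hle
  · have hg₀ : Ilam lam g₀ = Ilam lam (0 : Hn n → ℝ) := by
      funext u
      rw [Ilam_eq_zero_of_not_aestronglyMeasurable hn (fun hc => hnot (hc.mul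
        ((hzm.comp measurable_fst).pow_const β).aestronglyMeasurable)) u]
      simp [Ilam]
    rw [hg₀]
    refine exists_subseq_ae_tendsto_Ilam hn h₁ h₂ hm hlam0 hlamQ hmeas (by simp)
      hW.eLpNorm_ne_top hgM fun χ C hχ hle => ?_
    have := hpair χ C hχ hle
    rw [hzero _ (htest χ C hχ hle)] at this
    simpa using this
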